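/- Let $g \colon [-1,1] \to [-1,1]$ be smooth. Then the condition $2h\,g(h) + g'(h)(1-h^2) \neq 0$ for all $h \in [-1,1]$ is necessary and sufficient for the $1$-form $\beta_g = g(h)\,d\theta + \frac{1}{2}(x\,dy - y\,dx)$ on $\mathbb{S}^1 \times \mathbb{S}^{2d}$ to be a contact form, i.e. for $\beta_g \wedge (d\beta_g)^d$ to be nowhere vanishing. -/

import Mathlib

/-- Ambient space with coordinates `(θ, x, y, h)` for `S¹ × S^{2d} ⊂ S¹ × ℂ^d × ℝ`,
where `z_j = x_j + i y_j`. -/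
abbrev Amb (d : ℕ) : Type := ℝ × (Fin d → ℝ) × (Fin d → ℝ) × ℝ

/-- The 1-form `β_g = g(h) dθ + ½ Σ (x_j dy_j - y_j dx_j)` evaluated at the point `p`
on the tangent vector `v`. -/
noncomputable def betaG (d : ℕ) (g : ℝ → ℝ) (p v : Amb d) : ℝ :=
  g p.2.2.2 * v.1 + (1 / 2) * ∑ j, (p.2.1 j * v.2.2.1 j - p.2.2.1 j * v.2.1 j)

/-- The 2-form `dβ_g = g'(h) dh ∧ dθ + Σ dx_j ∧ dy_j` evaluated at `p` on `(u, v)`. -/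
noncomputable def dbetaG (d : ℕ) (g : ℝ → ℝ) (p u v : Amb d) : ℝ :=
  deriv g p.2.2.2 * (u.2.2.2 * v.1 - u.1 * v.2.2.2) +
    ∑ j, (u.2.1 j * v.2.2.1 j - u.2.2.1 j * v.2.1 j)

/-- The `(2d+1)`-form `β_g ∧ (dβ_g)^d` (up to a positive combinatorial constant),
evaluated at `p` on the tangent vectors `v 0, …, v 2d`. -/
noncomputable def topForm (d : ℕ) (g : ℝ → ℝ) (p : Amb d) (v : Fin (2 * d + 1) → Amb d) : ℝ :=
  ∑ σ : Equiv.Perm (Fin (2 * d + 1)),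
    ((Equiv.Perm.sign σ : ℤ) : ℝ) *
      betaG d g p (v (σ ⟨0, by omega⟩)) *
      ∏ i : Fin d,
        dbetaG d g p (v (σ ⟨2 * (i : ℕ) + 1, by have := i.isLt; omega⟩))
          (v (σ ⟨2 * (i : ℕ) + 2, by have := i.isLt; omega⟩))

/-- The tangent space of `S¹ × S^{2d}` at a point `p` of the sphere. -/
def TangentAt (d : ℕ) (p : Amb d) : Set (Amb d) :=
  {v | p.2.2.2 * v.2.2.2 + ∑ j, (p.2.1 j * v.2.1 j + p.2.2.1 j * v.2.2.1 j) = 0}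

/-- The multilinear map `v ↦ β (v none) * ∏ i, ω (v (i, 0)) (v (i, 1))`, whose alternatization
is a positive multiple of `β ∧ ω ^ |κ|`. -/
noncomputable def wedgePow {κ E : Type*} [Fintype κ] [AddCommGroup E] [Module ℝ E]
    (β : E →ₗ[ℝ] ℝ) (ω : E →ₗ[ℝ] E →ₗ[ℝ] ℝ) :
    MultilinearMap ℝ (fun _ : Option (κ × Fin 2) => E) ℝ where
  toFun v := β (v none) * ∏ i, ω (v (some (i, 0))) (v (some (i, 1)))
  map_update_add' := by
    classical
    rintro _ v (_ | ⟨i, b⟩) x y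
    · simp [add_mul]
    · have hprod : ∀ z, ∏ j ∈ Finset.univ.erase i,
          ω (Function.update v (some (i, b)) z (some (j, 0)))
            (Function.update v (some (i, b)) z (some (j, 1))) =
          ∏ j ∈ Finset.univ.erase i, ω (v (some (j, 0))) (v (some (j, 1))) := fun z =>
        Finset.prod_congr rfl fun j hj => by
          have := Finset.ne_of_mem_erase hj
          simp [this]
      simp only [← Finset.mul_prod_erase Finset.univ _ (Finset.mem_univ i)]
      simp only [Function.update_apply, reduceCtorEq, if_false] at hprod ⊢
      simp only [hprod]
      fin_cases b <;> simp <;> ring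
  map_update_smul' := by
    classical
    rintro _ v (_ | ⟨i, b⟩) c x
    · simp [mul_assoc]
    · have hprod : ∀ z, ∏ j ∈ Finset.univ.erase i,
          ω (Function.update v (some (i, b)) z (some (j, 0)))
            (Function.update v (some (i, b)) z (some (j, 1))) =
          ∏ j ∈ Finset.univ.erase i, ω (v (some (j, 0))) (v (some (j, 1))) := fun z =>
        Finset.prod_congr rfl fun j hj => by
          have := Finset.ne_of_mem_erase hj
          simp [this]
      simp only [← Finset.mul_prod_erase Finset.univ _ (Finset.mem_univ i)]
      simp only [Function.update_apply, reduceCtorEq, if_false] at hprod ⊢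
      simp only [hprod]
      fin_cases b <;> simp <;> ring

theorem wedgePow_apply {κ E : Type*} [Fintype κ] [AddCommGroup E] [Module ℝ E]
    (β : E →ₗ[ℝ] ℝ) (ω : E →ₗ[ℝ] E →ₗ[ℝ] ℝ) (v : Option (κ × Fin 2) → E) :
    wedgePow β ω v = β (v none) * ∏ i, ω (v (some (i, 0))) (v (some (i, 1))) := rfl

/-- The alternatization of `wedgePow β ω` vanishes on families containing a common kernel vector. -/
theorem alternatization_wedgePow_eq_zero_of_kernel {κ E : Type*} [Fintype κ] [DecidableEq κ]
    [AddCommGroup E] [Module ℝ E] {β : E →ₗ[ℝ] ℝ} {ω : E →ₗ[ℝ] E →ₗ[ℝ] ℝ} (hω : ω.IsAlt)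
    {v : Option (κ × Fin 2) → E} {k : Option (κ × Fin 2)} (hβ : β (v k) = 0)
    (hk : ∀ l, ω (v k) (v l) = 0) : (wedgePow β ω).alternatization v = 0 := by
  rw [MultilinearMap.alternatization_apply]
  refine Finset.sum_eq_zero fun σ _ => ?_
  rw [MultilinearMap.domDomCongr_apply, wedgePow_apply]
  obtain ⟨l, rfl⟩ := σ.surjective k
  have hk' : ∀ m, ω (v m) (v (σ l)) = 0 := fun m => by rw [← hω.neg, hk, neg_zero]
  rcases l with _ | ⟨i, b⟩
  · simp [hβ]
  · rw [Finset.prod_eq_zero (Finset.mem_univ i), mul_zero, smul_zero]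
    fin_cases b
    · exact hk _
    · exact hk' _

/-- If `β` and `ω` have a common kernel vector on the subspace `T` of dimension at most
`2 |κ| + 1`, then `β ∧ ω ^ |κ|` vanishes on `T`. -/
theorem alternatization_wedgePow_eq_zero {κ E : Type*} [Fintype κ] [DecidableEq κ]
    [AddCommGroup E] [Module ℝ E] [FiniteDimensional ℝ E]
    {β : E →ₗ[ℝ] ℝ} {ω : E →ₗ[ℝ] E →ₗ[ℝ] ℝ} (hω : ω.IsAlt) {T : Submodule ℝ E}
    (hT : Module.finrank ℝ T ≤ Fintype.card (Option (κ × Fin 2))) {w : E} (hw : w ≠ 0)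
    (hwT : w ∈ T) (hβ : β w = 0) (hker : ∀ u ∈ T, ω w u = 0) {v : Option (κ × Fin 2) → E}
    (hv : ∀ k, v k ∈ T) : (wedgePow β ω).alternatization v = 0 := by
  by_cases hli : LinearIndependent ℝ v
  · have hspan : Submodule.span ℝ (Set.range v) = T :=
      Submodule.eq_of_le_of_finrank_le (Submodule.span_le.2 (Set.range_subset_iff.2 hv))
        (by rwa [finrank_span_eq_card hli])
    rw [← hspan, Submodule.mem_span_range_iff_exists_fun] at hwT
    obtain ⟨c, rfl⟩ := hwT
    obtain ⟨k, hk⟩ : ∃ k, c k ≠ 0 := by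
      by_contra! h
      exact hw (by simp [h])
    have hzero : (wedgePow β ω).alternatization
        (Function.update v k (∑ i, c i • v i)) = 0 := by
      apply alternatization_wedgePow_eq_zero_of_kernel hω (k := k)
      · rw [Function.update_self, hβ]
      · intro l
        rw [Function.update_self]
        by_cases hl : l = k
        · subst hl
          rw [Function.update_self]
          exact hω _
        · rw [Function.update_of_ne hl]
          exact hker _ (hv l)
    rw [AlternatingMap.map_update_sum, Finset.sum_eq_single k] at hzero
    · rw [AlternatingMap.map_update_smul, Function.update_eq_self, smul_eq_mul] at hzero
      exact (mul_eq_zero.1 hzero).resolve_left hk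
    · intro l _ hl
      rw [AlternatingMap.map_update_smul, AlternatingMap.map_update_self _ _ hl.symm, smul_zero]
    · simp
  · exact AlternatingMap.map_linearDependent _ _ hli

/-- Every term of the Pfaffian of the standard symplectic matrix is nonnegative. -/
theorem sign_mul_prod_standard_nonneg {κ : Type*} [Fintype κ] [DecidableEq κ]
    (σ : Equiv.Perm (κ × Fin 2)) :
    0 ≤ ((Equiv.Perm.sign σ : ℤ) : ℝ) * ∏ i, (if (σ (i, 0)).1 = (σ (i, 1)).1 then
      (((σ (i, 1)).2 : ℕ) : ℝ) - (((σ (i, 0)).2 : ℕ) : ℝ) else 0) := by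
  by_cases hσ : ∀ i, (σ (i, 0)).1 = (σ (i, 1)).1
  · have hfst : ∀ i b, (σ (i, b)).1 = (σ (i, 0)).1 := fun i b => by
      fin_cases b
      · rfl
      · exact (hσ i).symm
    have hτ : Function.Surjective fun i => (σ (i, 0)).1 := fun j => by
      obtain ⟨⟨i, b⟩, h⟩ := σ.surjective (j, 0)
      exact ⟨i, (hfst i b).symm.trans (by rw [h])⟩
    have hρ : ∀ i, Function.Injective fun b => (σ (i, b)).2 := fun i b c h => by
      have : (i, b) = (i, c) := σ.injective (Prod.ext (by rw [hfst i b, hfst i c]) h)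
      exact (Prod.ext_iff.1 this).2
    let τ : Equiv.Perm κ := Equiv.ofBijective _ (Finite.surjective_iff_bijective.1 hτ)
    let ρ : κ → Equiv.Perm (Fin 2) := fun i =>
      Equiv.ofBijective _ (Finite.injective_iff_bijective.1 (hρ i))
    have hdecomp : σ = Equiv.prodCongrLeft (fun _ => τ) * Equiv.prodCongrRight ρ := by
      ext ⟨i, b⟩ : 1
      exact Prod.ext (hfst i b) rfl
    have hsign : Equiv.Perm.sign σ = ∏ i, Equiv.Perm.sign (ρ i) := by
      rw [hdecomp, Equiv.Perm.sign_mul, Equiv.Perm.sign_prodCongrLeft,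
        Equiv.Perm.sign_prodCongrRight]
      simp
    have hperm : ∀ π : Equiv.Perm (Fin 2),
        ((Equiv.Perm.sign π : ℤ)) = ((π 1 : ℕ) : ℤ) - ((π 0 : ℕ) : ℤ) := by decide
    have hfactor : ∀ i, (if (σ (i, 0)).1 = (σ (i, 1)).1 then
        (((σ (i, 1)).2 : ℕ) : ℝ) - (((σ (i, 0)).2 : ℕ) : ℝ) else 0) =
        ((Equiv.Perm.sign (ρ i) : ℤ) : ℝ) := fun i => by
      rw [if_pos (hσ i), hperm]
      push_cast
      rfl
    simp only [hfactor, hsign]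
    push_cast
    exact mul_self_nonneg _
  · push Not at hσ
    obtain ⟨i, hi⟩ := hσ
    rw [Finset.prod_eq_zero (Finset.mem_univ i) (if_neg hi), mul_zero]

/-- `β ∧ ω ^ |κ|` does not vanish on a frame made of a vector transverse to `ker β` and of a
symplectic family in `ker β`. -/
theorem alternatization_wedgePow_ne_zero {κ E : Type*} [Fintype κ] [DecidableEq κ]
    [AddCommGroup E] [Module ℝ E] {β : E →ₗ[ℝ] ℝ} {ω : E →ₗ[ℝ] E →ₗ[ℝ] ℝ}
    {v : Option (κ × Fin 2) → E} (hnone : β (v none) ≠ 0) (hsome : ∀ k, β (v (some k)) = 0)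
    (hω : ∀ k l, ω (v (some k)) (v (some l)) =
      if k.1 = l.1 then ((l.2 : ℕ) : ℝ) - ((k.2 : ℕ) : ℝ) else 0) :
    (wedgePow β ω).alternatization v ≠ 0 := by
  have hterm : ∀ p : Option (κ × Fin 2) × Equiv.Perm (κ × Fin 2),
      Equiv.Perm.sign (Equiv.Perm.decomposeOption.symm p) •
        (wedgePow β ω).domDomCongr (Equiv.Perm.decomposeOption.symm p) v =
      β (v none) * if p.1 = none then ((Equiv.Perm.sign p.2 : ℤ) : ℝ) *
        ∏ i, (if (p.2 (i, 0)).1 = (p.2 (i, 1)).1 then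
          (((p.2 (i, 1)).2 : ℕ) : ℝ) - (((p.2 (i, 0)).2 : ℕ) : ℝ) else 0) else 0 := by
    rintro ⟨_ | k, σ⟩
    · rw [Equiv.Perm.decomposeOption_symm_sign, MultilinearMap.domDomCongr_apply, wedgePow_apply]
      simp only [Equiv.Perm.decomposeOption_symm_of_none_apply, Option.map_none, Option.map_some,
        hω, if_true, Units.smul_def, zsmul_eq_mul]
      ring
    · rw [MultilinearMap.domDomCongr_apply, wedgePow_apply]
      simp [hsome]
  rw [MultilinearMap.alternatization_apply, ← Equiv.sum_comp Equiv.Perm.decomposeOption.symm]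
  simp only [hterm]
  rw [← Finset.mul_sum]
  refine mul_ne_zero hnone (ne_of_gt ?_)
  refine Finset.sum_pos' (fun p _ => ?_) ⟨(none, 1), Finset.mem_univ _, by simp⟩
  split_ifs
  · exact sign_mul_prod_standard_nonneg p.2
  · exact le_rfl

theorem finrank_le_finrank_inf_ker_add_one {K E : Type*} [Field K] [AddCommGroup E] [Module K E]
    [FiniteDimensional K E] (W : Submodule K E) (f : E →ₗ[K] K) :
    Module.finrank K W ≤ Module.finrank K (W ⊓ LinearMap.ker f : Submodule K E) + 1 := by
  have h₁ := Submodule.finrank_sup_add_finrank_inf_eq W (LinearMap.ker f)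
  have h₂ := f.finrank_range_add_finrank_ker
  have h₃ := (LinearMap.range f).finrank_le
  have h₄ := (W ⊔ LinearMap.ker f).finrank_le
  rw [Module.finrank_self] at h₃
  omega

/-- A subspace of dimension at least `2 n` on which `ω` is nondegenerate contains a
symplectic family of `2 n` vectors. -/
theorem exists_symplectic_family {E : Type*} [AddCommGroup E] [Module ℝ E]
    [FiniteDimensional ℝ E] {ω : E →ₗ[ℝ] E →ₗ[ℝ] ℝ} (hω : ω.IsAlt) (n : ℕ) :
    ∀ W : Submodule ℝ E, 2 * n ≤ Module.finrank ℝ W →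
      (∀ v ∈ W, (∀ w ∈ W, ω v w = 0) → v = 0) →
      ∃ e : Fin n × Fin 2 → E, (∀ k, e k ∈ W) ∧ ∀ k l, ω (e k) (e l) =
        if k.1 = l.1 then ((l.2 : ℕ) : ℝ) - ((k.2 : ℕ) : ℝ) else 0 := by
  induction n with
  | zero => exact fun W _ _ => ⟨fun _ => 0, fun k => k.1.elim0, fun k => k.1.elim0⟩
  | succ n ih =>
    intro W hW hnd
    have hanti : ∀ x y, ω x y = -ω y x := fun x y => (hω.neg y x).symm
    obtain ⟨u, huW, hu⟩ := W.ne_bot_iff.1 (by rintro rfl; simp at hW)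
    obtain ⟨w₀, hw₀W, hw₀⟩ : ∃ w ∈ W, ω u w ≠ 0 := by
      by_contra! h
      exact hu (hnd u huW h)
    obtain ⟨w, hwW, huw⟩ : ∃ w ∈ W, ω u w = 1 :=
      ⟨(ω u w₀)⁻¹ • w₀, W.smul_mem _ hw₀W, by simp [hw₀]⟩
    have hwu : ω w u = -1 := by rw [hanti, huw]
    obtain ⟨e, he, hee⟩ := ih (W ⊓ LinearMap.ker (ω u) ⊓ LinearMap.ker (ω w))
      (by
        have h₁ := finrank_le_finrank_inf_ker_add_one W (ω u)
        have h₂ := finrank_le_finrank_inf_ker_add_one (W ⊓ LinearMap.ker (ω u)) (ω w)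
        omega)
      (by
        rintro v ⟨⟨hvW, hvu⟩, hvw⟩ hv
        rw [SetLike.mem_coe, LinearMap.mem_ker, hanti, neg_eq_zero] at hvu
        rw [SetLike.mem_coe, LinearMap.mem_ker, hanti, neg_eq_zero] at hvw
        refine hnd v hvW fun x hx => ?_
        have := hv (x + ω w x • u - ω u x • w) ⟨⟨W.sub_mem (W.add_mem hx (W.smul_mem _ huW))
          (W.smul_mem _ hwW), by simp [hω.self_eq_zero, huw]⟩, by
            simp [hω.self_eq_zero, hwu]⟩
        simpa [hvu, hvw] using this)
    have hue : ∀ k, ω u (e k) = 0 := fun k => (he k).1.2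
    have hwe : ∀ k, ω w (e k) = 0 := fun k => (he k).2
    have heu : ∀ k, ω (e k) u = 0 := fun k => by rw [hanti, hue, neg_zero]
    have hew : ∀ k, ω (e k) w = 0 := fun k => by rw [hanti, hwe, neg_zero]
    refine ⟨fun k => Fin.cases (![u, w] k.2) (fun i => e (i, k.2)) k.1, ?_, ?_⟩
    · rintro ⟨i, b⟩
      induction i using Fin.cases with
      | zero => fin_cases b <;> simpa
      | succ i => exact (he (i, b)).1.1
    · rintro ⟨i, b⟩ ⟨j, c⟩
      induction i using Fin.cases with
      | zero =>
        induction j using Fin.cases with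
        | zero => fin_cases b <;> fin_cases c <;> simp [hω.self_eq_zero, huw, hwu]
        | succ j => fin_cases b <;> simp [hue, hwe, (Fin.succ_ne_zero j).symm]
      | succ i =>
        induction j using Fin.cases with
        | zero => fin_cases c <;> simp [heu, hew]
        | succ j => simp [hee]

/-- `β ∧ ω ^ n` does not vanish on a subspace `T` of dimension at least `2 n + 1` when `ω` has on
`T` a kernel vector transverse to `ker β` and no common kernel vector with `β`. -/
theorem exists_alternatization_wedgePow_ne_zero {E : Type*} [AddCommGroup E] [Module ℝ E]
    [FiniteDimensional ℝ E] {β : E →ₗ[ℝ] ℝ} {ω : E →ₗ[ℝ] E →ₗ[ℝ] ℝ} (hω : ω.IsAlt) {n : ℕ}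
    {T : Submodule ℝ E} (hT : 2 * n + 1 ≤ Module.finrank ℝ T) {R : E} (hRT : R ∈ T)
    (hβR : β R ≠ 0) (hωR : ∀ u ∈ T, ω R u = 0)
    (hnd : ∀ w ∈ T, β w = 0 → (∀ u ∈ T, ω w u = 0) → w = 0) :
    ∃ v : Option (Fin n × Fin 2) → E, (∀ k, v k ∈ T) ∧
      (wedgePow β ω).alternatization v ≠ 0 := by
  obtain ⟨e, he, hee⟩ := exists_symplectic_family hω n (T ⊓ LinearMap.ker β)
    (by
      have := finrank_le_finrank_inf_ker_add_one T β
      omega)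
    (by
      rintro w ⟨hwT, hβw⟩ hw
      refine hnd w hwT hβw fun u hu => ?_
      have hwR : ω w R = 0 := by rw [← hω.neg, hωR w hwT, neg_zero]
      have := hw (u - (β u / β R) • R)
        ⟨T.sub_mem hu (T.smul_mem _ hRT), by simp [hβR]⟩
      simpa [hwR] using this)
  refine ⟨fun k => k.elim R e, ?_, alternatization_wedgePow_ne_zero hβR (fun k => (he k).2) hee⟩
  rintro (_ | k)
  · exact hRT
  · exact (he k).1

/-- `betaG d g p` as a linear form. -/
noncomputable def betaForm (d : ℕ) (g : ℝ → ℝ) (p : Amb d) : Amb d →ₗ[ℝ] ℝ where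
  toFun := betaG d g p
  map_add' u v := by
    simp only [betaG, Prod.fst_add, Prod.snd_add, Pi.add_apply, mul_add, add_sub_add_comm,
      Finset.sum_add_distrib]
    ring
  map_smul' c v := by
    simp only [betaG, Prod.smul_fst, Prod.smul_snd, Pi.smul_apply, smul_eq_mul,
      mul_left_comm _ c, ← mul_sub, ← Finset.mul_sum, RingHom.id_apply]
    ring

/-- `dbetaG d g p` as a bilinear form. -/
noncomputable def dbetaForm (d : ℕ) (g : ℝ → ℝ) (p : Amb d) : Amb d →ₗ[ℝ] Amb d →ₗ[ℝ] ℝ :=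
  LinearMap.mk₂ ℝ (dbetaG d g p)
    (fun u v w => by
      simp only [dbetaG, Prod.fst_add, Prod.snd_add, Pi.add_apply, add_mul, add_sub_add_comm,
        Finset.sum_add_distrib]
      ring)
    (fun c u v => by
      simp only [dbetaG, Prod.smul_fst, Prod.smul_snd, Pi.smul_apply, smul_eq_mul,
        mul_assoc, ← mul_sub, ← Finset.mul_sum]
      ring)
    (fun u v w => by
      simp only [dbetaG, Prod.fst_add, Prod.snd_add, Pi.add_apply, mul_add, add_sub_add_comm,
        Finset.sum_add_distrib]
      ring)
    (fun c u v => by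
      simp only [dbetaG, Prod.smul_fst, Prod.smul_snd, Pi.smul_apply, smul_eq_mul,
        mul_left_comm _ c, ← mul_sub, ← Finset.mul_sum]
      ring)

theorem dbetaForm_isAlt (d : ℕ) (g : ℝ → ℝ) (p : Amb d) : (dbetaForm d g p).IsAlt := fun u => by
  simp [dbetaForm, dbetaG, mul_comm]

/-- The conormal of the sphere at `p`, as a linear form. -/
noncomputable def conormalForm (d : ℕ) (p : Amb d) : Amb d →ₗ[ℝ] ℝ where
  toFun v := p.2.2.2 * v.2.2.2 + ∑ j, (p.2.1 j * v.2.1 j + p.2.2.1 j * v.2.2.1 j)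
  map_add' u v := by
    simp only [Prod.snd_add, Prod.fst_add, Pi.add_apply, mul_add, add_add_add_comm,
      Finset.sum_add_distrib]
  map_smul' c v := by
    simp only [Prod.smul_fst, Prod.smul_snd, Pi.smul_apply, smul_eq_mul,
      mul_left_comm _ c, ← mul_add, ← Finset.mul_sum, RingHom.id_apply]

theorem finrank_amb (d : ℕ) : Module.finrank ℝ (Amb d) = 2 * d + 2 := by
  simp [Amb]
  omega

theorem finrank_ker_conormalForm_add_one (d : ℕ) (p : Amb d)
    (hp : (∑ j, (p.2.1 j ^ 2 + p.2.2.1 j ^ 2)) + p.2.2.2 ^ 2 = 1) :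
    Module.finrank ℝ (LinearMap.ker (conormalForm d p)) = 2 * d + 1 := by
  have h₁ : conormalForm d p p = 1 := by
    simp only [conormalForm, LinearMap.coe_mk, AddHom.coe_mk, ← sq]
    linarith
  have h₂ := (conormalForm d p).finrank_range_add_finrank_ker
  rw [LinearMap.range_eq_top.2 (LinearMap.surjective (by rintro h; simp [h] at h₁)),
    finrank_top, Module.finrank_self, finrank_amb] at h₂
  omega

/-- The identification of `Option (Fin d × Fin 2)` with `Fin (2 * d + 1)` sending `none` to `0`
and `(i, b)` to `2 * i + 1 + b`. -/
def optionPairEquiv (d : ℕ) : Option (Fin d × Fin 2) ≃ Fin (2 * d + 1) :=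
  (finProdFinEquiv.trans (finCongr (Nat.mul_comm d 2))).optionCongr.trans
    (finSuccEquiv (2 * d)).symm

theorem topForm_eq_alternatization (d : ℕ) (g : ℝ → ℝ) (p : Amb d)
    (v : Fin (2 * d + 1) → Amb d) :
    topForm d g p v = (wedgePow (betaForm d g p) (dbetaForm d g p)).alternatization
      (v ∘ optionPairEquiv d) := by
  rw [topForm, MultilinearMap.alternatization_apply,
    ← Equiv.sum_comp (optionPairEquiv d).permCongr]
  refine Finset.sum_congr rfl fun σ _ => ?_
  have h₀ : (optionPairEquiv d).symm ⟨0, by omega⟩ = none := by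
    rw [Equiv.symm_apply_eq]
    rfl
  have h₁ : ∀ i : Fin d, (optionPairEquiv d).symm ⟨2 * (i : ℕ) + 1, by omega⟩ = some (i, 0) :=
    fun i => by
      rw [Equiv.symm_apply_eq]
      ext
      simp [optionPairEquiv]
  have h₂ : ∀ i : Fin d, (optionPairEquiv d).symm ⟨2 * (i : ℕ) + 2, by omega⟩ = some (i, 1) :=
    fun i => by
      rw [Equiv.symm_apply_eq]
      ext
      simp [optionPairEquiv]
      omega
  rw [Equiv.Perm.sign_permCongr, MultilinearMap.domDomCongr_apply, wedgePow_apply]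
  simp only [Equiv.permCongr_apply, h₀, h₁, h₂, Units.smul_def, zsmul_eq_mul, mul_assoc]
  rfl

theorem exists_topForm_ne_zero_iff (d : ℕ) (g : ℝ → ℝ) (p : Amb d) :
    (∃ v : Fin (2 * d + 1) → Amb d, (∀ i, v i ∈ TangentAt d p) ∧ topForm d g p v ≠ 0) ↔
    ∃ v : Option (Fin d × Fin 2) → Amb d, (∀ k, v k ∈ LinearMap.ker (conormalForm d p)) ∧
      (wedgePow (betaForm d g p) (dbetaForm d g p)).alternatization v ≠ 0 := by
  constructor
  · rintro ⟨v, hv, h⟩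
    exact ⟨v ∘ optionPairEquiv d, fun k => hv _, by rwa [← topForm_eq_alternatization]⟩
  · rintro ⟨v, hv, h⟩
    refine ⟨v ∘ (optionPairEquiv d).symm, fun i => hv _, ?_⟩
    rwa [topForm_eq_alternatization, Function.comp_assoc, Equiv.symm_comp_self, Function.comp_id]

/-- A multiple of the Reeb vector field of `β_g`. -/
noncomputable def reebVector (d : ℕ) (g : ℝ → ℝ) (p : Amb d) : Amb d :=
  (p.2.2.2, fun j => -(deriv g p.2.2.2 * p.2.2.1 j), fun j => deriv g p.2.2.2 * p.2.1 j, 0)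

theorem reebVector_mem (d : ℕ) (g : ℝ → ℝ) (p : Amb d) :
    reebVector d g p ∈ LinearMap.ker (conormalForm d p) := by
  simp only [LinearMap.mem_ker, conormalForm, reebVector, LinearMap.coe_mk, AddHom.coe_mk,
    mul_zero, zero_add]
  exact Finset.sum_eq_zero fun j _ => by ring

theorem betaG_reebVector (d : ℕ) (g : ℝ → ℝ) (p : Amb d)
    (hp : (∑ j, (p.2.1 j ^ 2 + p.2.2.1 j ^ 2)) + p.2.2.2 ^ 2 = 1) :
    betaG d g p (reebVector d g p) =
      (2 * p.2.2.2 * g p.2.2.2 + deriv g p.2.2.2 * (1 - p.2.2.2 ^ 2)) / 2 := by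
  have : ∑ j, (p.2.1 j * (deriv g p.2.2.2 * p.2.1 j) -
      p.2.2.1 j * -(deriv g p.2.2.2 * p.2.2.1 j)) =
      deriv g p.2.2.2 * ∑ j, (p.2.1 j ^ 2 + p.2.2.1 j ^ 2) := by
    rw [Finset.mul_sum]
    exact Finset.sum_congr rfl fun j _ => by ring
  simp only [betaG, reebVector, this]
  rw [eq_sub_of_add_eq hp]
  ring

theorem dbetaG_reebVector (d : ℕ) (g : ℝ → ℝ) (p : Amb d) {v : Amb d}
    (hv : v ∈ LinearMap.ker (conormalForm d p)) : dbetaG d g p (reebVector d g p) v = 0 := by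
  have hv' : p.2.2.2 * v.2.2.2 + ∑ j, (p.2.1 j * v.2.1 j + p.2.2.1 j * v.2.2.1 j) = 0 := hv
  have : ∑ j, (-(deriv g p.2.2.2 * p.2.2.1 j) * v.2.2.1 j -
      deriv g p.2.2.2 * p.2.1 j * v.2.1 j) =
      -(deriv g p.2.2.2 * ∑ j, (p.2.1 j * v.2.1 j + p.2.2.1 j * v.2.2.1 j)) := by
    rw [Finset.mul_sum, ← Finset.sum_neg_distrib]
    exact Finset.sum_congr rfl fun j _ => by ring
  simp only [dbetaG, reebVector, this]
  linear_combination -(deriv g p.2.2.2) * hv'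

theorem eq_zero_of_sum_sq_add_sq_eq_zero {ι : Type*} [Fintype ι] {x y : ι → ℝ}
    (h : ∑ j, (x j ^ 2 + y j ^ 2) = 0) : x = 0 ∧ y = 0 := by
  rw [Finset.sum_eq_zero_iff_of_nonneg fun j _ => by positivity] at h
  constructor <;> ext j <;> have := h j (Finset.mem_univ j) <;> simp only [Pi.zero_apply] <;>
    nlinarith [sq_nonneg (x j), sq_nonneg (y j)]

/-- If `2 h g(h) + g'(h) (1 - h²) ≠ 0`, then `β_g` and `dβ_g` have no common kernel vector on the
tangent space. -/
theorem eq_zero_of_betaG_dbetaG_eq_zero (d : ℕ) (g : ℝ → ℝ) (p : Amb d)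
    (hp : (∑ j, (p.2.1 j ^ 2 + p.2.2.1 j ^ 2)) + p.2.2.2 ^ 2 = 1)
    (hD : 2 * p.2.2.2 * g p.2.2.2 + deriv g p.2.2.2 * (1 - p.2.2.2 ^ 2) ≠ 0) {w : Amb d}
    (hw : w ∈ LinearMap.ker (conormalForm d p)) (hβ : betaG d g p w = 0)
    (hker : ∀ u ∈ LinearMap.ker (conormalForm d p), dbetaG d g p w u = 0) : w = 0 := by
  obtain ⟨t, x, y, h⟩ := p
  obtain ⟨a, X, Y, c⟩ := w
  replace hker : ∀ (b : ℝ) (ξ η : Fin d → ℝ) (s : ℝ),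
      h * s + ∑ j, (x j * ξ j + y j * η j) = 0 →
      deriv g h * (c * b - a * s) + ∑ j, (X j * η j - Y j * ξ j) = 0 :=
    fun b ξ η s hs => hker (b, ξ, η, s) hs
  replace hw : h * c + ∑ j, (x j * X j + y j * Y j) = 0 := hw
  replace hβ : g h * a + 1 / 2 * ∑ j, (x j * Y j - y j * X j) = 0 := hβ
  simp only at hp hD
  suffices a = 0 ∧ (X = 0 ∧ Y = 0) ∧ c = 0 by
    obtain ⟨rfl, ⟨rfl, rfl⟩, rfl⟩ := this
    rfl
  by_cases hh : h = 0
  · subst hh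
    have hg' : deriv g 0 ≠ 0 := by
      rintro h0
      simp [h0] at hD
    have hc : c = 0 := by simpa [hg'] using hker 1 0 0 0 (by simp)
    have ha : a = 0 := by simpa [hg'] using hker 0 0 0 1 (by simp)
    subst hc ha
    refine ⟨rfl, eq_zero_of_sum_sq_add_sq_eq_zero ?_, rfl⟩
    have hrot : ∑ j, (x j * (-Y) j + y j * X j) = -∑ j, (x j * Y j - y j * X j) := by
      rw [← Finset.sum_neg_distrib]
      exact Finset.sum_congr rfl fun j _ => by simp; ring
    have := hker 0 (-Y) X 0 (by rw [hrot]; linarith)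
    simpa [← sq] using this
  · have hzero := hker 0 (fun j => h * -(h * Y j - deriv g h * a * x j))
      (fun j => h * (h * X j + deriv g h * a * y j))
      (-∑ j, (x j * -(h * Y j - deriv g h * a * x j) + y j * (h * X j + deriv g h * a * y j)))
      (by
        simp only [mul_left_comm _ h, ← mul_add, ← Finset.mul_sum]
        ring)
    have hsq := eq_zero_of_sum_sq_add_sq_eq_zero
      (x := fun j => h * Y j - deriv g h * a * x j)
      (y := fun j => h * X j + deriv g h * a * y j) (by
        rw [← hzero, mul_zero, zero_sub, mul_neg, mul_neg, mul_neg, neg_neg, ← mul_assoc,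
          Finset.mul_sum, ← Finset.sum_add_distrib]
        exact Finset.sum_congr rfl fun j _ => by ring)
    have hY : ∀ j, h * Y j = deriv g h * a * x j := fun j =>
      sub_eq_zero.1 (congrFun hsq.1 j)
    have hX : ∀ j, h * X j = -(deriv g h * a * y j) := fun j =>
      eq_neg_of_add_eq_zero_left (congrFun hsq.2 j)
    have hsum : h * ∑ j, (x j * Y j - y j * X j) =
        deriv g h * a * ∑ j, (x j ^ 2 + y j ^ 2) := by
      rw [Finset.mul_sum, Finset.mul_sum]
      exact Finset.sum_congr rfl fun j _ => by linear_combination x j * hY j - y j * hX j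
    have ha : a = 0 := by
      refine (mul_eq_zero.1 ?_).resolve_left hD
      linear_combination 2 * h * hβ - hsum - deriv g h * a * hp
    subst ha
    have hX0 : X = 0 := funext fun j => by simpa [hh] using hX j
    have hY0 : Y = 0 := funext fun j => by simpa [hh] using hY j
    subst hX0 hY0
    exact ⟨rfl, ⟨rfl, rfl⟩, by simpa [hh] using hw⟩

/-- If `2 h g(h) + g'(h) (1 - h²) = 0`, then `β_g` and `dβ_g` have a common nonzero kernel vector
on the tangent space. -/
theorem exists_common_kernel_vector (d : ℕ) (g : ℝ → ℝ) (p : Amb d)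
    (hp : (∑ j, (p.2.1 j ^ 2 + p.2.2.1 j ^ 2)) + p.2.2.2 ^ 2 = 1)
    (hD : 2 * p.2.2.2 * g p.2.2.2 + deriv g p.2.2.2 * (1 - p.2.2.2 ^ 2) = 0) :
    ∃ w ∈ LinearMap.ker (conormalForm d p), w ≠ 0 ∧ betaG d g p w = 0 ∧
      ∀ u ∈ LinearMap.ker (conormalForm d p), dbetaG d g p w u = 0 := by
  by_cases hh : p.2.2.2 = 0
  · have hg' : deriv g p.2.2.2 = 0 := by simpa [hh] using hD
    refine ⟨(0, 0, 0, 1), ?_, ?_, ?_, fun u _ => ?_⟩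
    · simp [conormalForm, hh]
    · simp [Prod.ext_iff]
    · simp [betaG]
    · simp [dbetaG, hg']
  · refine ⟨reebVector d g p, reebVector_mem d g p, fun h0 => hh (congrArg Prod.fst h0), ?_,
      fun u => dbetaG_reebVector d g p⟩
    rw [betaG_reebVector d g p hp, hD, zero_div]

theorem exists_topForm_ne_zero_iff_ne_zero (d : ℕ) (g : ℝ → ℝ) (p : Amb d)
    (hp : (∑ j, (p.2.1 j ^ 2 + p.2.2.1 j ^ 2)) + p.2.2.2 ^ 2 = 1) :
    (∃ v : Fin (2 * d + 1) → Amb d, (∀ i, v i ∈ TangentAt d p) ∧ topForm d g p v ≠ 0) ↔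
      2 * p.2.2.2 * g p.2.2.2 + deriv g p.2.2.2 * (1 - p.2.2.2 ^ 2) ≠ 0 := by
  have hrank := finrank_ker_conormalForm_add_one d p hp
  rw [exists_topForm_ne_zero_iff]
  constructor
  · rintro ⟨v, hv, h⟩ hD
    obtain ⟨w, hwT, hw, hβ, hker⟩ := exists_common_kernel_vector d g p hp hD
    refine h (alternatization_wedgePow_eq_zero (dbetaForm_isAlt d g p) ?_ hw hwT hβ hker hv)
    rw [hrank, Fintype.card_congr (optionPairEquiv d), Fintype.card_fin]
  · intro hD
    refine exists_alternatization_wedgePow_ne_zero (dbetaForm_isAlt d g p) hrank.ge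
      (reebVector_mem d g p) ?_ (fun u => dbetaG_reebVector d g p)
      fun w => eq_zero_of_betaG_dbetaG_eq_zero d g p hp hD
    exact (betaG_reebVector d g p hp).trans_ne (div_ne_zero hD two_ne_zero)

/-- Lemma 4.4: `β_g` is a contact form on `S¹ × S^{2d}`, i.e. `β_g ∧ (dβ_g)^d` is
nowhere vanishing on tangent spaces, iff `2 h g(h) + g'(h)(1-h²) ≠ 0` for all `h ∈ [-1,1]`. -/
theorem betaG_contact_iff (d : ℕ) (hd : 1 ≤ d) (g : ℝ → ℝ) (hg : ContDiff ℝ (⊤ : ℕ∞) g)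
    (hmap : ∀ h ∈ Set.Icc (-1 : ℝ) 1, g h ∈ Set.Icc (-1 : ℝ) 1) :
    (∀ p : Amb d, (∑ j, (p.2.1 j ^ 2 + p.2.2.1 j ^ 2)) + p.2.2.2 ^ 2 = 1 →
      ∃ v : Fin (2 * d + 1) → Amb d, (∀ i, v i ∈ TangentAt d p) ∧ topForm d g p v ≠ 0) ↔
    (∀ h ∈ Set.Icc (-1 : ℝ) 1, 2 * h * g h + deriv g h * (1 - h ^ 2) ≠ 0) := by
  constructor
  · intro H h hh
    have hnonneg : 0 ≤ 1 - h ^ 2 := by nlinarith [hh.1, hh.2]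
    let p : Amb d := (0, Pi.single ⟨0, hd⟩ √(1 - h ^ 2), 0, h)
    have hp : (∑ j, (p.2.1 j ^ 2 + p.2.2.1 j ^ 2)) + p.2.2.2 ^ 2 = 1 := by
      simp [p, Pi.single_apply, ite_pow, Real.sq_sqrt hnonneg]
    exact (exists_topForm_ne_zero_iff_ne_zero d g p hp).1 (H p hp)
  · intro H p hp
    have hsq : p.2.2.2 ^ 2 ≤ 1 := by
      have : 0 ≤ ∑ j, (p.2.1 j ^ 2 + p.2.2.1 j ^ 2) := Finset.sum_nonneg fun j _ => by positivity
      linarith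
    exact (exists_topForm_ne_zero_iff_ne_zero d g p hp).2
      (H _ (abs_le.1 ((sq_le_one_iff_abs_le_one _).1 hsq)))
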